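/- arXiv:2406.03574 — 6 statements merged into one kernel-verified Lean document; each statement's English description precedes it below -/
import Mathlib

section
/- Let n, m : ℕ, A : Matrix (Fin m) (Fin n) ℝ with A i k ≥ 0 for all i, k; b : Fin m → ℝ with b i ≥ 0 for all i; β : ℝ with β ≥ 0; and x', x^O : Fin n → ℝ with x' j ≥ 0 and x^O j ≥ 0 for all j. Say j ∈ Fin n is 'accepted' if for every i, ∑_{k ∈ Fin n, k ≤ j} A i k · x' k ≤ β · b i, and define the switching output x : Fin n → ℝ by x j = (x^O j + x' j)/2 if j is accepted and x j = x^O j otherwise. If the online solution is β-feasible, i.e., ∑_{j} A i j · x^O j ≤ β · b i for every i, then the switching output is (3β/2)-feasible: ∑_{j} A i j · x j ≤ (3/2) · β · b i for every i. -/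
/-- If every initial sum of a nonnegative `f` ending at a point of `s` is at most `c`, then so is the
sum of `f` over `s`. -/
theorem Finset.sum_le_of_forall_initial_sum_le {ι : Type*} [Fintype ι] [LinearOrder ι]
    {f : ι → ℝ} (hf : ∀ k, 0 ≤ f k) {c : ℝ} (hc : 0 ≤ c) (s : Finset ι)
    (h : ∀ j ∈ s, ∑ k ∈ Finset.univ.filter (fun k => k ≤ j), f k ≤ c) :
    ∑ k ∈ s, f k ≤ c := by
  rcases s.eq_empty_or_nonempty with rfl | hs
  · simpa using hc
  · refine le_trans ?_ (h _ (s.max'_mem hs))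
    refine Finset.sum_le_sum_of_subset_of_nonneg (fun k hk => ?_) fun k _ _ => hf k
    simpa using s.le_max' k hk

/-- Feasibility guarantee of the switching algorithm: given a β-feasible
online solution, the output is (3β/2)-feasible. -/
theorem switching_feasibility (n m : ℕ) (A : Matrix (Fin m) (Fin n) ℝ)
    (hA : ∀ i k, 0 ≤ A i k) (b : Fin m → ℝ) (hb : ∀ i, 0 ≤ b i)
    (β : ℝ) (hβ : 0 ≤ β)
    (x' xO : Fin n → ℝ) (hx' : ∀ j, 0 ≤ x' j) (hxO : ∀ j, 0 ≤ xO j)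
    (x : Fin n → ℝ)
    (hx_acc : ∀ j : Fin n,
      (∀ i, ∑ k ∈ Finset.univ.filter (fun k => k ≤ j), A i k * x' k ≤ β * b i) →
      x j = (xO j + x' j) / 2)
    (hx_rej : ∀ j : Fin n,
      ¬ (∀ i, ∑ k ∈ Finset.univ.filter (fun k => k ≤ j), A i k * x' k ≤ β * b i) →
      x j = xO j)
    (hO_feas : ∀ i, ∑ j, A i j * xO j ≤ β * b i) :
    ∀ i, ∑ j, A i j * x j ≤ (3 / 2) * β * b i := by
  classical
  intro i
  have trimmed := Finset.sum_le_of_forall_initial_sum_le (f := fun k => A i k * x' k)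
    (fun k => mul_nonneg (hA i k) (hx' k)) (mul_nonneg hβ (hb i))
    (Finset.univ.filter fun j => ∀ i,
      ∑ k ∈ Finset.univ.filter (fun k => k ≤ j), A i k * x' k ≤ β * b i)
    fun j hj => (Finset.mem_filter.1 hj).2 i
  rw [Finset.sum_filter] at trimmed
  calc ∑ j, A i j * x j
      ≤ ∑ j, (A i j * xO j + (1 / 2) * if ∀ i,
          ∑ k ∈ Finset.univ.filter (fun k => k ≤ j), A i k * x' k ≤ β * b i
          then A i j * x' j else 0) := by
        refine Finset.sum_le_sum fun j _ => ?_
        have hj := mul_nonneg (hA i j) (hxO j)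
        split_ifs with h
        · rw [hx_acc j h]
          linarith
        · rw [hx_rej j h]
          linarith
    _ ≤ (3 / 2) * β * b i := by
        rw [Finset.sum_add_distrib, ← Finset.mul_sum]
        linarith [hO_feas i]
end

section
/- Let n, m : ℕ, A : Matrix (Fin m) (Fin n) ℝ with A i k ≥ 0 for all i, k; b : Fin m → ℝ; β : ℝ; x', x^O : Fin n → ℝ with x' j ≥ 0 and x^O j ≥ 0 for all j; and let f : (Fin n → ℝ) → ℝ satisfy f(δ•u + (1−δ)•v) ≥ δ·f(u) + (1−δ)·f(v) for all coordinatewise-nonnegative u, v and δ ∈ [0,1], f(u) ≥ f(v) whenever u ≥ v ≥ 0 coordinatewise, and f(0) = 0. Say j ∈ Fin n is 'accepted' if for every i, ∑_{k ∈ Fin n, k ≤ j} A i k · x' k ≤ β · b i, and define the switching output x : Fin n → ℝ by x j = (x^O j + x' j)/2 if j is accepted and x j = x^O j otherwise. Then f(x) ≥ f(x^O)/2. -/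
/-- Robustness guarantee of the switching algorithm: the output always
achieves at least half the objective value of the online solution. -/
theorem switching_robustness (n m : ℕ) (A : Matrix (Fin m) (Fin n) ℝ)
    (hA : ∀ i k, 0 ≤ A i k) (b : Fin m → ℝ) (β : ℝ)
    (x' xO : Fin n → ℝ) (hx' : ∀ j, 0 ≤ x' j) (hxO : ∀ j, 0 ≤ xO j)
    (f : (Fin n → ℝ) → ℝ)
    (hconc : ∀ u v : Fin n → ℝ, (∀ k, 0 ≤ u k) → (∀ k, 0 ≤ v k) →
      ∀ δ : ℝ, δ ∈ Set.Icc (0 : ℝ) 1 →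
        δ * f u + (1 - δ) * f v ≤ f (δ • u + (1 - δ) • v))
    (hmono : ∀ u v : Fin n → ℝ, (∀ k, v k ≤ u k) → (∀ k, 0 ≤ v k) → f v ≤ f u)
    (hzero : f 0 = 0)
    (x : Fin n → ℝ)
    (hx_acc : ∀ j : Fin n,
      (∀ i, ∑ k ∈ Finset.univ.filter (fun k => k ≤ j), A i k * x' k ≤ β * b i) →
      x j = (xO j + x' j) / 2)
    (hx_rej : ∀ j : Fin n,
      ¬ (∀ i, ∑ k ∈ Finset.univ.filter (fun k => k ≤ j), A i k * x' k ≤ β * b i) →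
      x j = xO j) :
    f xO / 2 ≤ f x := by
  have hhalf := hconc xO 0 hxO (fun _ => le_rfl) (1 / 2) ⟨by norm_num, by norm_num⟩
  have hdom : ∀ k, ((1 / 2 : ℝ) • xO + (1 - 1 / 2 : ℝ) • (0 : Fin n → ℝ)) k ≤ x k := by
    intro k
    simp only [Pi.add_apply, Pi.smul_apply, Pi.zero_apply, smul_eq_mul]
    by_cases h : ∀ i, ∑ l ∈ Finset.univ.filter (fun l => l ≤ k), A i l * x' l ≤ β * b i
    · linarith [hx_acc k h, hx' k]
    · linarith [hx_rej k h, hxO k]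
  have hnonneg : ∀ k, 0 ≤ ((1 / 2 : ℝ) • xO + (1 - 1 / 2 : ℝ) • (0 : Fin n → ℝ)) k := by
    intro k
    simp only [Pi.add_apply, Pi.smul_apply, Pi.zero_apply, smul_eq_mul]
    linarith [hxO k]
  linarith [hmono x _ hdom hnonneg]
end

section
/- Let n, m : ℕ, A : Matrix (Fin m) (Fin n) ℝ with A i k ≥ 0 for all i, k; b : Fin m → ℝ; β : ℝ; x', x^O : Fin n → ℝ with x' j ≥ 0 and x^O j ≥ 0 for all j; and let f : (Fin n → ℝ) → ℝ satisfy f(δ•u + (1−δ)•v) ≥ δ·f(u) + (1−δ)·f(v) for all coordinatewise-nonnegative u, v and δ ∈ [0,1], f(u) ≥ f(v) whenever u ≥ v ≥ 0 coordinatewise, and f(0) = 0. Say j ∈ Fin n is 'accepted' if for every i, ∑_{k ∈ Fin n, k ≤ j} A i k · x' k ≤ β · b i, and define the switching output x : Fin n → ℝ by x j = (x^O j + x' j)/2 if j is accepted and x j = x^O j otherwise. If the advice is β-feasible, i.e., ∑_{j} A i j · x' j ≤ β · b i for every i, then every round is accepted, hence x j = (x^O j + x' j)/2 for all j, and f(x)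 ≥ f(x')/2. -/
/-- Consistency guarantee of the switching algorithm: when the advice is
β-feasible, every round is accepted, the output is the coordinatewise average
of the online solution and the advice, and its value is at least half the
value of the advice. -/
theorem switching_consistency (n m : ℕ) (A : Matrix (Fin m) (Fin n) ℝ)
    (hA : ∀ i k, 0 ≤ A i k) (b : Fin m → ℝ) (β : ℝ)
    (x' xO : Fin n → ℝ) (hx' : ∀ j, 0 ≤ x' j) (hxO : ∀ j, 0 ≤ xO j)
    (f : (Fin n → ℝ) → ℝ)
    (hconc : ∀ u v : Fin n → ℝ, (∀ k, 0 ≤ u k) → (∀ k, 0 ≤ v k) →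
      ∀ δ : ℝ, δ ∈ Set.Icc (0 : ℝ) 1 →
        δ * f u + (1 - δ) * f v ≤ f (δ • u + (1 - δ) • v))
    (hmono : ∀ u v : Fin n → ℝ, (∀ k, v k ≤ u k) → (∀ k, 0 ≤ v k) → f v ≤ f u)
    (hzero : f 0 = 0)
    (x : Fin n → ℝ)
    (hx_acc : ∀ j : Fin n,
      (∀ i, ∑ k ∈ Finset.univ.filter (fun k => k ≤ j), A i k * x' k ≤ β * b i) →
      x j = (xO j + x' j) / 2)
    (hx_rej : ∀ j : Fin n,
      ¬ (∀ i, ∑ k ∈ Finset.univ.filter (fun k => k ≤ j), A i k * x' k ≤ β * b i) →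
      x j = xO j)
    (hadv_feas : ∀ i, ∑ j, A i j * x' j ≤ β * b i) :
    (∀ j : Fin n, ∀ i,
        ∑ k ∈ Finset.univ.filter (fun k => k ≤ j), A i k * x' k ≤ β * b i) ∧
    (∀ j : Fin n, x j = (xO j + x' j) / 2) ∧
    f x' / 2 ≤ f x := by
  have hacc : ∀ j : Fin n, ∀ i,
      ∑ k ∈ Finset.univ.filter (fun k => k ≤ j), A i k * x' k ≤ β * b i := fun j i =>
    (Finset.sum_le_sum_of_subset_of_nonneg (Finset.filter_subset _ _)
      fun k _ _ => mul_nonneg (hA i k) (hx' k)).trans (hadv_feas i)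
  have hx : ∀ j : Fin n, x j = (xO j + x' j) / 2 := fun j => hx_acc j (hacc j)
  refine ⟨hacc, hx, ?_⟩
  have hhalf := hconc x' 0 hx' (fun _ => le_rfl) (1 / 2) ⟨by norm_num, by norm_num⟩
  rw [smul_zero, add_zero, hzero, mul_zero, add_zero] at hhalf
  have hle : f ((1 / 2 : ℝ) • x') ≤ f x := by
    refine hmono _ _ (fun k => ?_) (fun k => ?_)
    · rw [hx k, Pi.smul_apply, smul_eq_mul]
      linarith [hxO k]
    · exact mul_nonneg (by norm_num) (hx' k)
  linarith
end

section
/- Let n, m : ℕ, A : Matrix (Fin m) (Fin n) ℝ with A i k ≥ 0 for all i, k; b : Fin m → ℝ with b i > 0 for all i; β : ℝ with β ≥ 1; x', x^O : Fin n → ℝ with x' j ≥ 0 and x^O j ≥ 0 for all j; and let f : (Fin n → ℝ) → ℝ satisfy f(δ•u + (1−δ)•v) ≥ δ·f(u) + (1−δ)·f(v) for all coordinatewise-nonnegative u, v and δ ∈ [0,1], f(u) ≥ f(v) whenever u ≥ v ≥ 0 coordinatewise, and f(0) = 0. Say j ∈ Fin n is 'accepted' if for every i, ∑_{k ∈ Fin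 n, k ≤ j} A i k · x' k ≤ β · b i, and define the switching output x : Fin n → ℝ by x j = (x^O j + x' j)/2 if j is accepted and x j = x^O j otherwise. If ∑_{j} A i j · x^O j ≤ β · b i for every i, then all three of the following hold: (1) f(x) ≥ f(x^O)/2; (2) if moreover ∑_{j} A i j · x' j ≤ β · b i for every i, then f(x) ≥ f(x')/2; and (3) ∑_{j} A i j · x j ≤ (3/2) · β · b i for every i. -/
/-- A monotone function that is concave on the nonnegative orthant and vanishes at the origin
loses at most half its value when its argument is at least halved. -/
theorem half_le_of_half_le {n : ℕ} {f : (Fin n → ℝ) → ℝ}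
    (hconc : ∀ u v : Fin n → ℝ, (∀ k, 0 ≤ u k) → (∀ k, 0 ≤ v k) →
      ∀ δ : ℝ, δ ∈ Set.Icc (0 : ℝ) 1 →
        δ * f u + (1 - δ) * f v ≤ f (δ • u + (1 - δ) • v))
    (hmono : ∀ u v : Fin n → ℝ, (∀ k, v k ≤ u k) → (∀ k, 0 ≤ v k) → f v ≤ f u)
    (hzero : f 0 = 0) {x y : Fin n → ℝ} (hy : ∀ j, 0 ≤ y j) (hxy : ∀ j, y j / 2 ≤ x j) :
    f y / 2 ≤ f x := by
  have hhalf := hconc y 0 hy (fun _ => le_rfl) (1 / 2) (by norm_num)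
  rw [hzero, smul_zero, add_zero] at hhalf
  have hle : f ((1 / 2 : ℝ) • y) ≤ f x := by
    refine hmono _ _ (fun k => ?_) (fun k => ?_) <;>
      simp only [Pi.smul_apply, smul_eq_mul] <;> linarith [hxy k, hy k]
  linarith

/-- If every prefix sum ending at an index of `s` is at most `c`, then so is the sum over `s`. -/
theorem sum_le_of_prefix_sum_le {ι : Type*} [Fintype ι] [LinearOrder ι] {g : ι → ℝ} {c : ℝ}
    (hg : ∀ k, 0 ≤ g k) (hc : 0 ≤ c) (s : Finset ι)
    (hs : ∀ j ∈ s, ∑ k ∈ Finset.univ.filter (fun k => k ≤ j), g k ≤ c) :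
    ∑ k ∈ s, g k ≤ c := by
  rcases s.eq_empty_or_nonempty with rfl | hne
  · simpa using hc
  · refine le_trans (Finset.sum_le_sum_of_subset_of_nonneg (fun k hk => ?_)
      (fun k _ _ => hg k)) (hs _ (s.max'_mem hne))
    simpa using s.le_max' k hk

/-- Theorem 1 of the paper in explicit form: the switching algorithm is
(2, β)-consistent, 2-robust with respect to the online solution, and
(3β/2)-feasible. -/
theorem switching_main (n m : ℕ) (A : Matrix (Fin m) (Fin n) ℝ)
    (hA : ∀ i k, 0 ≤ A i k) (b : Fin m → ℝ) (hb : ∀ i, 0 < b i)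
    (β : ℝ) (hβ : 1 ≤ β)
    (x' xO : Fin n → ℝ) (hx' : ∀ j, 0 ≤ x' j) (hxO : ∀ j, 0 ≤ xO j)
    (f : (Fin n → ℝ) → ℝ)
    (hconc : ∀ u v : Fin n → ℝ, (∀ k, 0 ≤ u k) → (∀ k, 0 ≤ v k) →
      ∀ δ : ℝ, δ ∈ Set.Icc (0 : ℝ) 1 →
        δ * f u + (1 - δ) * f v ≤ f (δ • u + (1 - δ) • v))
    (hmono : ∀ u v : Fin n → ℝ, (∀ k, v k ≤ u k) → (∀ k, 0 ≤ v k) → f v ≤ f u)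
    (hzero : f 0 = 0)
    (x : Fin n → ℝ)
    (hx_acc : ∀ j : Fin n,
      (∀ i, ∑ k ∈ Finset.univ.filter (fun k => k ≤ j), A i k * x' k ≤ β * b i) →
      x j = (xO j + x' j) / 2)
    (hx_rej : ∀ j : Fin n,
      ¬ (∀ i, ∑ k ∈ Finset.univ.filter (fun k => k ≤ j), A i k * x' k ≤ β * b i) →
      x j = xO j)
    (hO_feas : ∀ i, ∑ j, A i j * xO j ≤ β * b i) :
    (f xO / 2 ≤ f x) ∧
    ((∀ i, ∑ j, A i j * x' j ≤ β * b i) → f x' / 2 ≤ f x) ∧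
    (∀ i, ∑ j, A i j * x j ≤ (3 / 2) * β * b i) := by
  classical
  refine ⟨half_le_of_half_le hconc hmono hzero hxO fun j => ?_, fun hfeas =>
    half_le_of_half_le hconc hmono hzero hx' fun j => ?_, fun i => ?_⟩
  · by_cases h : ∀ i, ∑ k ∈ Finset.univ.filter (fun k => k ≤ j), A i k * x' k ≤ β * b i
    · linarith [hx_acc j h, hx' j]
    · linarith [hx_rej j h, hxO j]
  · have h := hx_acc j fun i => le_trans (Finset.sum_le_sum_of_subset_of_nonneg
      (Finset.filter_subset _ _) fun k _ _ => mul_nonneg (hA i k) (hx' k)) (hfeas i)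
    linarith [hxO j]
  · let s : Finset (Fin n) := Finset.univ.filter fun j =>
      ∀ i, ∑ k ∈ Finset.univ.filter (fun k => k ≤ j), A i k * x' k ≤ β * b i
    have hs : ∑ k ∈ s, A i k * x' k ≤ β * b i :=
      sum_le_of_prefix_sum_le (fun k => mul_nonneg (hA i k) (hx' k))
        (mul_nonneg (zero_le_one.trans hβ) (hb i).le) s
        fun j hj => (Finset.mem_filter.mp hj).2 i
    have hle : ∑ j, A i j * x j ≤
        ∑ j, (A i j * xO j + (if j ∈ s then A i j * x' j else 0) / 2) := by
      refine Finset.sum_le_sum fun j _ => ?_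
      by_cases h : ∀ i, ∑ k ∈ Finset.univ.filter (fun k => k ≤ j), A i k * x' k ≤ β * b i
      · rw [if_pos (Finset.mem_filter.mpr ⟨Finset.mem_univ j, h⟩), hx_acc j h]
        linarith [mul_nonneg (hA i j) (hxO j)]
      · rw [if_neg (fun hj => h (Finset.mem_filter.mp hj).2), hx_rej j h]
        linarith
    rw [Finset.sum_add_distrib, ← Finset.sum_div, Finset.sum_ite_mem, Finset.univ_inter] at hle
    linarith [hO_feas i]
end

section
/- Let n, m : ℕ, A : Matrix (Fin m) (Fin n) ℝ with A i k ≥ 0 for all i, k; b : Fin m → ℝ; β : ℝ; α : ℝ with α > 0; x', x^O : Fin n → ℝ with x' j ≥ 0 and x^O j ≥ 0 for all j; and let f : (Fin n → ℝ) → ℝ satisfy f(δ•u + (1−δ)•v) ≥ δ·f(u) + (1−δ)·f(v) for all coordinatewise-nonnegative u, v and δ ∈ [0,1], f(u) ≥ f(v) whenever u ≥ v ≥ 0 coordinatewise, and f(0) = 0. Say j ∈ Fin n is 'accepted' if for every i, ∑_{k ∈ Fin n, k ≤ j} A i k · x' k ≤ β · b i, and define the switching output x : Fin n → ℝ by x j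 = (x^O j + x' j)/2 if j is accepted and x j = x^O j otherwise. Suppose the online solution is α-competitive: for every y : Fin n → ℝ with y j ≥ 0 for all j and ∑_{j} A i j · y j ≤ b i for every i, one has f(x^O) ≥ f(y)/α. Then for every such feasible y, f(x) ≥ f(y)/(2α). -/
/-- 2α-robustness against the offline optimum: if the online solution is
α-competitive with every feasible point, the switching output is
2α-competitive with every feasible point. -/
theorem switching_two_alpha_robust (n m : ℕ) (A : Matrix (Fin m) (Fin n) ℝ)
    (hA : ∀ i k, 0 ≤ A i k) (b : Fin m → ℝ) (β : ℝ) (α : ℝ) (hα : 0 < α)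
    (x' xO : Fin n → ℝ) (hx' : ∀ j, 0 ≤ x' j) (hxO : ∀ j, 0 ≤ xO j)
    (f : (Fin n → ℝ) → ℝ)
    (hconc : ∀ u v : Fin n → ℝ, (∀ k, 0 ≤ u k) → (∀ k, 0 ≤ v k) →
      ∀ δ : ℝ, δ ∈ Set.Icc (0 : ℝ) 1 →
        δ * f u + (1 - δ) * f v ≤ f (δ • u + (1 - δ) • v))
    (hmono : ∀ u v : Fin n → ℝ, (∀ k, v k ≤ u k) → (∀ k, 0 ≤ v k) → f v ≤ f u)
    (hzero : f 0 = 0)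
    (x : Fin n → ℝ)
    (hx_acc : ∀ j : Fin n,
      (∀ i, ∑ k ∈ Finset.univ.filter (fun k => k ≤ j), A i k * x' k ≤ β * b i) →
      x j = (xO j + x' j) / 2)
    (hx_rej : ∀ j : Fin n,
      ¬ (∀ i, ∑ k ∈ Finset.univ.filter (fun k => k ≤ j), A i k * x' k ≤ β * b i) →
      x j = xO j)
    (hcomp : ∀ y : Fin n → ℝ, (∀ j, 0 ≤ y j) → (∀ i, ∑ j, A i j * y j ≤ b i) →
      f y / α ≤ f xO) :
    ∀ y : Fin n → ℝ, (∀ j, 0 ≤ y j) → (∀ i, ∑ j, A i j * y j ≤ b i) →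
      f y / (2 * α) ≤ f x := by
  intro y hy hyb
  have half_le : ∀ j, ((1 / 2 : ℝ) • xO + (1 - 1 / 2 : ℝ) • (0 : Fin n → ℝ)) j ≤ x j := by
    intro j
    have hO := hxO j
    have h' := hx' j
    simp only [smul_zero, add_zero, Pi.smul_apply, smul_eq_mul]
    by_cases hj : ∀ i, ∑ k ∈ Finset.univ.filter (fun k => k ≤ j), A i k * x' k ≤ β * b i
    · rw [hx_acc j hj]
      linarith
    · rw [hx_rej j hj]
      linarith
  have half_nonneg :
      ∀ j, 0 ≤ ((1 / 2 : ℝ) • xO + (1 - 1 / 2 : ℝ) • (0 : Fin n → ℝ)) j := by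
    intro j
    have hO := hxO j
    simp only [smul_zero, add_zero, Pi.smul_apply, smul_eq_mul]
    linarith
  have f_half := hconc xO 0 hxO (fun _ => le_rfl) (1 / 2) ⟨by norm_num, by norm_num⟩
  have f_mono := hmono x _ half_le half_nonneg
  have f_comp := hcomp y hy hyb
  have split : f y / (2 * α) = f y / α / 2 := by
    rw [div_div, mul_comm]
  rw [split]
  linarith
end

section
/- Let n, m : ℕ, A : Matrix (Fin m) (Fin n) ℝ with A i k ≥ 0 for all i, k; b : Fin m → ℝ with b i > 0 for all i; β : ℝ with β ≥ 1; B : ℝ with B > 0; and x', x^O : Fin n → ℝ with x' j ≥ 0 and x^O j ≥ 0 for all j. Say j ∈ Fin n is 'accepted' if for every i, ∑_{k ∈ Fin n, k ≤ j} A i k · x' k ≤ β · b i, and define the switching output x : Fin n → ℝ by x j = (x^O j + x' j)/2 if j is accepted and x j = x^O j otherwise. Suppose the online solution is β-feasible and B-competitive for the linear objective: ∑_{j} A i j · x^O j ≤ β · b i for every i, and for every y : Fin n → ℝ with y j ≥ 0 for all j and ∑_{j} A i j · y j ≤ b i for every i, one has ∑_{j} x^O j ≥ (1/B) · ∑_{j}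 y j. Then: (1) for every such feasible y, ∑_{j} x j ≥ (1/(2B)) · ∑_{j} y j; (2) if ∑_{j} A i j · x' j ≤ β · b i for every i, then ∑_{j} x j ≥ (1/2) · ∑_{j} x' j; and (3) ∑_{j} A i j · x j ≤ (3/2) · β · b i for every i. -/
/-- If every element of `s` has an initial-segment sum at most `C`, then so does `s` itself. -/
theorem Finset.sum_le_of_forall_sum_initial_segment_le {ι : Type*} [Fintype ι] [LinearOrder ι]
    {f : ι → ℝ} (hf : ∀ k, 0 ≤ f k) {C : ℝ} (hC : 0 ≤ C) (s : Finset ι)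
    (hs : ∀ j ∈ s, ∑ k ∈ Finset.univ.filter (fun k => k ≤ j), f k ≤ C) :
    ∑ k ∈ s, f k ≤ C := by
  rcases s.eq_empty_or_nonempty with rfl | hne
  · simpa using hC
  · refine le_trans (Finset.sum_le_sum_of_subset_of_nonneg ?_ fun k _ _ => hf k)
      (hs _ (s.max'_mem hne))
    intro k hk
    simpa using s.le_max' k hk

/-- Corollary 3 of the paper for online packing LPs: given a B-competitive,
β-feasible online solution, the switching algorithm is (2, β)-consistent,
2B-robust, and (3β/2)-feasible for the linear objective `∑ j, x j`. -/
theorem packing_lp_switching (n m : ℕ) (A : Matrix (Fin m) (Fin n) ℝ)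
    (hA : ∀ i k, 0 ≤ A i k) (b : Fin m → ℝ) (hb : ∀ i, 0 < b i)
    (β : ℝ) (hβ : 1 ≤ β) (B : ℝ) (hB : 0 < B)
    (x' xO : Fin n → ℝ) (hx' : ∀ j, 0 ≤ x' j) (hxO : ∀ j, 0 ≤ xO j)
    (x : Fin n → ℝ)
    (hx_acc : ∀ j : Fin n,
      (∀ i, ∑ k ∈ Finset.univ.filter (fun k => k ≤ j), A i k * x' k ≤ β * b i) →
      x j = (xO j + x' j) / 2)
    (hx_rej : ∀ j : Fin n,
      ¬ (∀ i, ∑ k ∈ Finset.univ.filter (fun k => k ≤ j), A i k * x' k ≤ β * b i) →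
      x j = xO j)
    (hO_feas : ∀ i, ∑ j, A i j * xO j ≤ β * b i)
    (hO_comp : ∀ y : Fin n → ℝ, (∀ j, 0 ≤ y j) → (∀ i, ∑ j, A i j * y j ≤ b i) →
      (1 / B) * ∑ j, y j ≤ ∑ j, xO j) :
    (∀ y : Fin n → ℝ, (∀ j, 0 ≤ y j) → (∀ i, ∑ j, A i j * y j ≤ b i) →
      (1 / (2 * B)) * ∑ j, y j ≤ ∑ j, x j) ∧
    ((∀ i, ∑ j, A i j * x' j ≤ β * b i) → (1 / 2) * ∑ j, x' j ≤ ∑ j, x j) ∧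
    (∀ i, ∑ j, A i j * x j ≤ (3 / 2) * β * b i) := by
  classical
  refine ⟨fun y hy hyb => ?_, fun hfeas => ?_, fun i => ?_⟩
  · have hhalf : (1 / 2) * ∑ j, xO j ≤ ∑ j, x j := by
      rw [Finset.mul_sum]
      refine Finset.sum_le_sum fun j _ => ?_
      have h1 := hx' j
      have h2 := hxO j
      by_cases h : ∀ i, ∑ k ∈ Finset.univ.filter (fun k => k ≤ j), A i k * x' k ≤ β * b i
      · rw [hx_acc j h]; linarith
      · rw [hx_rej j h]; linarith
    calc (1 / (2 * B)) * ∑ j, y j = (1 / 2) * ((1 / B) * ∑ j, y j) := by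
          field_simp
      _ ≤ (1 / 2) * ∑ j, xO j := by linarith [hO_comp y hy hyb]
      _ ≤ ∑ j, x j := hhalf
  · rw [Finset.mul_sum]
    refine Finset.sum_le_sum fun j _ => ?_
    rw [hx_acc j fun i => (Finset.sum_le_sum_of_subset_of_nonneg (Finset.subset_univ _)
      fun k _ _ => mul_nonneg (hA i k) (hx' k)).trans (hfeas i)]
    linarith [hxO j]
  · set S : Finset (Fin n) := Finset.univ.filter fun j =>
      ∀ i, ∑ k ∈ Finset.univ.filter (fun k => k ≤ j), A i k * x' k ≤ β * b i with hS
    have hacc : ∑ j ∈ S, A i j * x' j ≤ β * b i :=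
      Finset.sum_le_of_forall_sum_initial_segment_le
        (fun k => mul_nonneg (hA i k) (hx' k))
        (mul_nonneg (by linarith) (hb i).le) S
        fun j hj => (Finset.mem_filter.mp hj).2 i
    have hle : ∑ j, A i j * x j ≤ ∑ j, A i j * xO j + (1 / 2) * ∑ j ∈ S, A i j * x' j := by
      rw [hS, Finset.sum_filter, Finset.mul_sum, ← Finset.sum_add_distrib]
      refine Finset.sum_le_sum fun j _ => ?_
      have h2 := mul_nonneg (hA i j) (hxO j)
      split_ifs with h
      · rw [hx_acc j h]; linarith
      · rw [hx_rej j h]; linarith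
    linarith [hO_feas i]
end
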